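/- arXiv:2108.03114 — 5 statements merged into one kernel-verified Lean document; each statement's English description precedes it below -/
import Mathlib

section
/- Let n ≥ 1, let X = {(x,y) ∈ ℤ² : max(|x|,|y|) = n} be the boundary of the square [−n,n]²ℤ, and let Y = X \ {(n,n)}. Then for every (c₁,c₁)-continuous function f : X → Y there exists a point P ∈ X such that d₁(P, f(P)) ≥ 2n − 1 or d₁(−P, f(−P)) ≥ 2n − 1, where −P denotes the antipode of P. Consequently, Borsuk's metric of continuity (based on the Manhattan metric d₁ and the c₁-adjacency) satisfies δ_{d₁}(X,Y) ≥ 2n − 1. -/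
/-- `c₁`-adjacency on `ℤ²`: the points differ by exactly 1 in exactly one
coordinate and agree in the other. -/
def c1Adj (x y : ℤ × ℤ) : Prop :=
  (|x.1 - y.1| = 1 ∧ x.2 = y.2) ∨ (x.1 = y.1 ∧ |x.2 - y.2| = 1)

/-- The Manhattan (city-block) metric on `ℤ²`, real-valued. -/
noncomputable def d1 (x y : ℤ × ℤ) : ℝ :=
  ((|x.1 - y.1| + |x.2 - y.2| : ℤ) : ℝ)

/-- Borsuk's metric of continuity for digital images in `ℤ²` with the
`c₁`-adjacency, based on the Manhattan metric `d1`: the infimum of `t > 0`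
admitting continuous maps in both directions moving points by at most `t`. -/
noncomputable def borsukDelta (X Y : Set (ℤ × ℤ)) : ℝ :=
  sInf {t : ℝ | 0 < t ∧
    ∃ f g : ℤ × ℤ → ℤ × ℤ,
      (∀ x ∈ X, f x ∈ Y) ∧ (∀ y ∈ Y, g y ∈ X) ∧
      (∀ x ∈ X, ∀ x' ∈ X, c1Adj x x' → (f x = f x' ∨ c1Adj (f x) (f x'))) ∧
      (∀ y ∈ Y, ∀ y' ∈ Y, c1Adj y y' → (g y = g y' ∨ c1Adj (g y) (g y'))) ∧
      (∀ x ∈ X, d1 x (f x) ≤ t) ∧ (∀ y ∈ Y, d1 y (g y) ≤ t)}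

theorem bd_cross (N : ℕ) (h : ℕ → ℤ) (hs : ∀ k < N, |h (k+1) - h k| ≤ 2) (hN : h N = - h 0) :
    ∃ k ≤ N, |h k| ≤ 1 := by
  by_contra! hc
  have h0 := hc 0 (Nat.zero_le _)
  have hNN := hc N le_rfl
  by_cases hp : 0 ≤ h 0
  · have : ∀ k ≤ N, 0 ≤ h k := by
      intro k
      induction k with
      | zero => intro _; exact hp
      | succ k ih =>
        intro hk
        have a1 := ih (by omega)
        have a2 := hc k (by omega)
        have a3 := hc (k+1) hk
        have a4 := hs k (by omega)
        grind
    have := this N le_rfl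
    grind
  · have : ∀ k ≤ N, h k < 0 := by
      intro k
      induction k with
      | zero => intro _; omega
      | succ k ih =>
        intro hk
        have a1 := ih (by omega)
        have a2 := hc k (by omega)
        have a3 := hc (k+1) hk
        have a4 := hs k (by omega)
        grind
    have := this N le_rfl
    grind

def bdU (n : ℤ) (p : ℤ × ℤ) : ℤ :=
  if p.2 ≤ p.1 then p.1 + p.2 + 2 * n else -(p.1 + p.2 + 2 * n)

def bdOn (n : ℤ) (p : ℤ × ℤ) : Prop :=
  ((p.1 = n ∨ p.1 = -n) ∧ -n ≤ p.2 ∧ p.2 ≤ n) ∨ ((p.2 = n ∨ p.2 = -n) ∧ -n ≤ p.1 ∧ p.1 ≤ n)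

theorem bdOn_iff (n : ℤ) (hn : 1 ≤ n) (p : ℤ × ℤ) : max |p.1| |p.2| = n ↔ bdOn n p := by
  unfold bdOn
  rcases abs_cases p.1 with h | h <;> rcases abs_cases p.2 with h' | h' <;>
    rcases max_cases |p.1| |p.2| with h2 | h2 <;> omega

theorem c1Adj_iff (p q : ℤ × ℤ) : c1Adj p q ↔
    (((p.1 - q.1 = 1 ∨ p.1 - q.1 = -1) ∧ p.2 = q.2) ∨
     (p.1 = q.1 ∧ (p.2 - q.2 = 1 ∨ p.2 - q.2 = -1))) := by
  unfold c1Adj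
  rw [abs_eq (by norm_num), abs_eq (by norm_num)]

theorem bdU_cont (n : ℤ) (hn : 1 ≤ n) (p q : ℤ × ℤ) (hp : bdOn n p) (hq : bdOn n q)
    (hp' : p ≠ (n, n)) (hq' : q ≠ (n, n)) (h : p = q ∨ c1Adj p q) :
    bdU n p - bdU n q ≤ 1 ∧ bdU n q - bdU n p ≤ 1 := by
  rcases h with rfl | h
  · omega
  obtain ⟨a, b⟩ := p
  obtain ⟨c, d⟩ := q
  rw [c1Adj_iff] at h
  simp only [bdU, bdOn, ne_eq, Prod.mk.injEq] at *
  split_ifs <;> omega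

theorem bdU_inj (n : ℤ) (hn : 1 ≤ n) (p q : ℤ × ℤ) (hp : bdOn n p) (hq : bdOn n q)
    (hp' : p ≠ (n, n)) (hq' : q ≠ (n, n)) (h : |bdU n p - bdU n q| ≤ 1) :
    |p.1 - q.1| + |p.2 - q.2| ≤ 1 := by
  obtain ⟨a, b⟩ := p
  obtain ⟨c, d⟩ := q
  rw [abs_le] at h
  simp only [bdU, bdOn, ne_eq, Prod.mk.injEq] at *
  rcases abs_cases (a - c) with h1 | h1 <;> rcases abs_cases (b - d) with h2 | h2 <;>
    split_ifs at h <;> omega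

theorem bd_far (n : ℤ) (hn : 1 ≤ n) (p q r : ℤ × ℤ) (hp : bdOn n p) (hq : bdOn n q)
    (h : |q.1 - r.1| + |q.2 - r.2| ≤ 1) :
    2 * n - 1 ≤ |p.1 - q.1| + |p.2 - q.2| ∨ 2 * n - 1 ≤ |(-p).1 - r.1| + |(-p).2 - r.2| := by
  have key : 2 * n ≤ |p.1 - q.1| + |p.2 - q.2| ∨ 2 * n ≤ |(-p).1 - q.1| + |(-p).2 - q.2| := by
    obtain ⟨a, b⟩ := p
    obtain ⟨c, d⟩ := q
    simp only [bdOn, Prod.neg_mk] at *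
    have e1 := le_abs_self (a - c)
    have e2 := neg_abs_le (a - c)
    have e3 := le_abs_self (b - d)
    have e4 := neg_abs_le (b - d)
    have e5 := le_abs_self (-a - c)
    have e6 := neg_abs_le (-a - c)
    have e7 := le_abs_self (-b - d)
    have e8 := neg_abs_le (-b - d)
    omega
  have t1 := abs_sub_le (-p).1 r.1 q.1
  have t2 := abs_sub_le (-p).2 r.2 q.2
  rw [abs_sub_comm r.1] at t1
  rw [abs_sub_comm r.2] at t2
  omega

def bdG (n : ℤ) (k : ℕ) : ℤ × ℤ := if (k : ℤ) ≤ 2 * n then (n, k - n) else (3 * n - k, n)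

theorem bdG_on (n : ℤ) (hn : 1 ≤ n) (k : ℕ) (hk : (k : ℤ) ≤ 4 * n) : bdOn n (bdG n k) := by
  unfold bdG bdOn
  split_ifs <;> grind

theorem bdOn_neg (n : ℤ) (p : ℤ × ℤ) (h : bdOn n p) : bdOn n (-p) := by
  unfold bdOn at *
  simp only [Prod.fst_neg, Prod.snd_neg]
  omega

theorem bdG_adj (n : ℤ) (hn : 1 ≤ n) (k : ℕ) : c1Adj (bdG n (k+1)) (bdG n k) := by
  rw [c1Adj_iff]
  unfold bdG
  push_cast
  split_ifs <;> grind

theorem c1Adj_neg (p q : ℤ × ℤ) (h : c1Adj p q) : c1Adj (-p) (-q) := by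
  rw [c1Adj_iff] at *
  simp only [Prod.fst_neg, Prod.snd_neg]
  omega

/-- For the boundary `X` of `[-n,n]²` in `ℤ²` and
`Y = X \ {(n,n)}`, every `(c₁,c₁)`-continuous `f : X → Y` moves some point
`P` or its antipode `-P` by at least `2n-1` in the Manhattan metric; hence
`δ_{d₁}(X,Y) ≥ 2n-1`. -/
theorem borsuk_delta_boundary_square_minus_corner
    (n : ℕ) (hn : 1 ≤ n)
    (X Y : Set (ℤ × ℤ))
    (hX : X = {p : ℤ × ℤ | max |p.1| |p.2| = (n : ℤ)})
    (hY : Y = X \ {((n : ℤ), (n : ℤ))}) :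
    (∀ f : ℤ × ℤ → ℤ × ℤ,
      (∀ x ∈ X, f x ∈ Y) →
      (∀ x ∈ X, ∀ x' ∈ X, c1Adj x x' → (f x = f x' ∨ c1Adj (f x) (f x'))) →
      ∃ P ∈ X, (2 * (n : ℝ) - 1 ≤ d1 P (f P) ∨ 2 * (n : ℝ) - 1 ≤ d1 (-P) (f (-P)))) ∧
    2 * (n : ℝ) - 1 ≤ borsukDelta X Y := by
  have hn' : (1 : ℤ) ≤ n := by exact_mod_cast hn
  have mX : ∀ p, p ∈ X ↔ bdOn n p := by
    intro p
    rw [hX, ← bdOn_iff n hn' p]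
    rfl
  have mY : ∀ p, p ∈ Y ↔ bdOn n p ∧ p ≠ ((n : ℤ), (n : ℤ)) := by
    intro p
    rw [hY, ← mX]
    rfl
  have main : ∀ f : ℤ × ℤ → ℤ × ℤ,
      (∀ x ∈ X, f x ∈ Y) →
      (∀ x ∈ X, ∀ x' ∈ X, c1Adj x x' → (f x = f x' ∨ c1Adj (f x) (f x'))) →
      ∃ P ∈ X, (2 * (n : ℝ) - 1 ≤ d1 P (f P) ∨ 2 * (n : ℝ) - 1 ≤ d1 (-P) (f (-P))) := by
    intro f hf hc
    have step : ∀ p q, bdOn n p → bdOn n q → c1Adj p q →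
        bdU n (f p) - bdU n (f q) ≤ 1 ∧ bdU n (f q) - bdU n (f p) ≤ 1 := by
      intro p q hp hq h
      have a := (mY _).1 (hf p ((mX p).2 hp))
      have b := (mY _).1 (hf q ((mX q).2 hq))
      exact bdU_cont n hn' _ _ a.1 b.1 a.2 b.2 (hc p ((mX p).2 hp) q ((mX q).2 hq) h)
    obtain ⟨k, hk, hk1⟩ := bd_cross (4 * n)
      (fun k => bdU n (f (bdG n k)) - bdU n (f (-(bdG n k))))
      (by
        intro k hk
        have o1 := bdG_on n hn' k (by omega)
        have o2 := bdG_on n hn' (k+1) (by omega)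
        have s1 := step _ _ o2 o1 (bdG_adj n hn' k)
        have s2 := step _ _ (bdOn_neg n _ o2) (bdOn_neg n _ o1) (c1Adj_neg _ _ (bdG_adj n hn' k))
        simp only [abs_le]
        omega)
      (by
        have e : bdG n (4 * n) = - bdG n 0 := by
          unfold bdG
          rw [if_neg (by push_cast; omega), if_pos (by push_cast; omega)]
          ext <;> simp <;> ring
        simp only [e, neg_neg]
        ring)
    have o := bdG_on n hn' k (by omega)
    have a := (mY _).1 (hf _ ((mX _).2 o))
    have b := (mY _).1 (hf _ ((mX _).2 (bdOn_neg n _ o)))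
    refine ⟨bdG n k, (mX _).2 o, ?_⟩
    have := bd_far n hn' _ _ _ o a.1 (bdU_inj n hn' _ _ a.1 b.1 a.2 b.2 hk1)
    unfold d1
    rcases this with h | h
    · left
      exact_mod_cast h
    · right
      exact_mod_cast h
  refine ⟨main, ?_⟩
  unfold borsukDelta
  apply le_csInf
  · have hc : bdOn n ((-n : ℤ), (n : ℤ)) := by unfold bdOn; grind
    have hcY : ((-n : ℤ), (n : ℤ)) ∈ Y := by
      rw [mY]
      refine ⟨hc, ?_⟩
      simp only [ne_eq, Prod.mk.injEq]
      omega
    have bound : ∀ p, bdOn n p → d1 p ((-n : ℤ), (n : ℤ)) ≤ 4 * (n : ℝ) := by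
      intro p hp
      have : |p.1 - (-n : ℤ)| + |p.2 - (n : ℤ)| ≤ 4 * (n : ℤ) := by
        unfold bdOn at hp
        rcases abs_cases (p.1 - (-n : ℤ)) with h1 | h1 <;>
          rcases abs_cases (p.2 - (n : ℤ)) with h2 | h2 <;> omega
      unfold d1
      exact_mod_cast this
    refine ⟨4 * (n : ℝ), by positivity, fun _ => ((-n : ℤ), (n : ℤ)), fun _ => ((-n : ℤ), (n : ℤ)),
      fun _ _ => hcY, fun _ _ => (mX _).2 hc, fun _ _ _ _ _ => Or.inl rfl,
      fun _ _ _ _ _ => Or.inl rfl, fun x hx => bound x ((mX x).1 hx),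
      fun x hx => bound x ((mY x).1 hx).1⟩
  · rintro t ⟨_, f, g, hf, _, hc, _, hd, _⟩
    obtain ⟨P, hP, h | h⟩ := main f hf hc
    · exact h.trans (hd P hP)
    · exact h.trans (hd (-P) ((mX _).2 (bdOn_neg n _ ((mX _).1 hP))))
end

section
/- Let n ∈ ℕ be even with n ≥ 2. Let Q = [0,n]ℤ × [0,n]ℤ ⊂ ℤ² and let S = Q \ [ (⋃_{k∈ℤ} {4k+1} × [1,n]ℤ) ∪ (⋃_{k∈ℤ} {4k+3} × [0,n−1]ℤ) ]. Then, with respect to the shortest-path metric induced by c₁-adjacency within each set, diam_{c₁}(Q) = 2n and diam_{c₁}(S) = n + n(1 + n/2). Consequently s_{c₁}(Q,S) = |diam_{c₁}(Q) − diam_{c₁}(S)| = n²/2. -/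
/-- `pathIn adj X m a b` : there is a path of length `m` in `X` from `a` to `b`
with consecutive points `adj`-adjacent. -/
def pathIn {α : Type*} (adj : α → α → Prop) (X : Set α) (m : ℕ) (a b : α) : Prop :=
  ∃ f : ℕ → α, f 0 = a ∧ f m = b ∧ (∀ i ≤ m, f i ∈ X) ∧ ∀ i < m, adj (f i) (f (i + 1))

/-- The shortest-path distance in `X` between `a` and `b`. -/
noncomputable def dSP {α : Type*} (adj : α → α → Prop) (X : Set α) (a b : α) : ℕ :=
  sInf {m : ℕ | pathIn adj X m a b}

/-- The diameter of `X` in the shortest-path metric. -/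
noncomputable def diamSP {α : Type*} (adj : α → α → Prop) (X : Set α) : ℕ :=
  sSup {d : ℕ | ∃ a ∈ X, ∃ b ∈ X, d = dSP adj X a b}


theorem pathIn_of_descent {α : Type*} {adj : α → α → Prop} {X : Set α} (b : α) (μ : α → ℕ)
    (h0 : ∀ p ∈ X, μ p = 0 → p = b)
    (hs : ∀ p ∈ X, μ p ≠ 0 → ∃ q ∈ X, adj p q ∧ μ q + 1 = μ p) :
    ∀ (k : ℕ) (p : α), p ∈ X → μ p = k → pathIn adj X k p b := by
  intro k
  induction k with
  | zero =>
    intro p hp hk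
    exact ⟨fun _ => p, rfl, h0 p hp hk, fun _ _ => hp, fun i hi => absurd hi (by omega)⟩
  | succ k ih =>
    intro p hp hk
    obtain ⟨q, hq, hpq, hμ⟩ := hs p hp (by omega)
    obtain ⟨f, f0, fk, fX, fa⟩ := ih q hq (by omega)
    refine ⟨fun i => Nat.casesOn i p f, rfl, fk, ?_, ?_⟩
    · rintro (_ | i) hi
      · exact hp
      · exact fX i (by omega)
    · rintro (_ | i) hi
      · show adj p (f 0)
        rw [f0]; exact hpq
      · exact fa i (by omega)

theorem pathIn_lip {α : Type*} {adj : α → α → Prop} {X : Set α} (φ : α → ℤ)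
    (h : ∀ p ∈ X, ∀ q ∈ X, adj p q → φ q ≤ φ p + 1) {m : ℕ} {a b : α}
    (hp : pathIn adj X m a b) : φ b ≤ φ a + m := by
  obtain ⟨f, f0, fm, fX, fa⟩ := hp
  have key : ∀ i : ℕ, i ≤ m → φ (f i) ≤ φ a + i := by
    intro i
    induction i with
    | zero => intro _; simp [f0]
    | succ i ih =>
      intro hi
      have h1 := ih (by omega)
      have h2 := h _ (fX i (by omega)) _ (fX (i+1) hi) (fa i (by omega))
      push_cast; linarith
  rw [← fm]; exact key m le_rfl

theorem diamSP_eq {α : Type*} {adj : α → α → Prop} {X : Set α} (L : ℕ)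
    (hu : ∀ a ∈ X, ∀ b ∈ X, ∃ m ≤ L, pathIn adj X m a b)
    (hl : ∃ a ∈ X, ∃ b ∈ X, ∀ m, pathIn adj X m a b → L ≤ m) : diamSP adj X = L := by
  have hb : ∀ a ∈ X, ∀ b ∈ X, dSP adj X a b ≤ L := by
    intro a ha b hb
    obtain ⟨m, hm, hp⟩ := hu a ha b hb
    exact (Nat.sInf_le hp).trans hm
  obtain ⟨a, ha, b, hb', h⟩ := hl
  apply le_antisymm
  · refine csSup_le (s := {d : ℕ | ∃ a ∈ X, ∃ b ∈ X, d = dSP adj X a b}) ⟨_, a, ha, b, hb', rfl⟩ ?_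
    rintro d ⟨a, ha, b, hb', rfl⟩
    exact hb a ha b hb'
  · have h1 : L ≤ dSP adj X a b := by
      obtain ⟨m, hm, hp⟩ := hu a ha b hb'
      exact h _ (Nat.sInf_mem (s := {m : ℕ | pathIn adj X m a b}) ⟨m, hp⟩)
    refine h1.trans (le_csSup ⟨L, ?_⟩ ⟨a, ha, b, hb', rfl⟩)
    rintro d ⟨a, ha, b, hb', rfl⟩
    exact hb a ha b hb'

theorem diam_square (n : ℕ) (Q : Set (ℤ × ℤ))
    (hQ : ∀ x y : ℤ, (x, y) ∈ Q ↔ 0 ≤ x ∧ x ≤ n ∧ 0 ≤ y ∧ y ≤ n) :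
    diamSP c1Adj Q = 2 * n := by
  apply diamSP_eq
  · rintro ⟨x, y⟩ ha ⟨u, v⟩ hb
    refine ⟨_, ?_, pathIn_of_descent (u, v)
      (fun p => (p.1 - u).natAbs + (p.2 - v).natAbs) ?_ ?_ _ (x, y) ha rfl⟩
    · rw [hQ] at ha hb
      dsimp only; omega
    · rintro ⟨x, y⟩ hp h
      dsimp only at h
      ext <;> dsimp only <;> omega
    · rintro ⟨x, y⟩ hp h
      rw [hQ] at hp hb
      dsimp only at h
      simp only [Prod.exists, hQ, c1Adj]
      rcases lt_trichotomy x u with h1 | h1 | h1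
      · refine ⟨x + 1, y, by omega, by left; simp, by omega⟩
      · rcases lt_trichotomy y v with h2 | h2 | h2
        · refine ⟨x, y + 1, by omega, by right; simp, by omega⟩
        · omega
        · refine ⟨x, y - 1, by omega, by right; simp, by omega⟩
      · refine ⟨x - 1, y, by omega, by left; simp, by omega⟩
  · refine ⟨(0, 0), (hQ _ _).2 (by omega), (n, n), (hQ _ _).2 (by omega), fun m hm => ?_⟩
    have := pathIn_lip (fun p : ℤ × ℤ => p.1 + p.2) ?_ hm
    · dsimp only at this; omega
    · rintro ⟨x, y⟩ - ⟨u, v⟩ - h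
      simp only [c1Adj] at h
      dsimp only
      rcases h with ⟨h, h'⟩ | ⟨h, h'⟩
      · have := neg_abs_le (x - u); omega
      · have := neg_abs_le (y - v); omega

/-- remainder within a block of the snake -/
def snR (h x y : ℤ) : ℤ :=
  if x % 4 = 0 then 2 * h - y else if x % 4 = 2 then y else 2 * h + 1

/-- position along the snake -/
def snP (h : ℤ) (p : ℤ × ℤ) : ℤ := (2 * h + 2) * (p.1 / 2) + snR h p.1 p.2

def snIn (h x y : ℤ) : Prop :=
  0 ≤ x ∧ x ≤ 2 * h ∧ 0 ≤ y ∧ y ≤ 2 * h ∧ (x % 4 = 1 → y = 0) ∧ (x % 4 = 3 → y = 2 * h)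

theorem snP_bounds (h x y : ℤ) (hp : snIn h x y) :
    0 ≤ snP h (x, y) ∧ snP h (x, y) ≤ (2 * h + 2) * h + 2 * h := by
  obtain ⟨h1, h2, h3, h4, h5, h6⟩ := hp
  have hr : 0 ≤ snR h x y ∧ snR h x y ≤ 2 * h + 1 := by unfold snR; split_ifs <;> omega
  have hr2 : x % 2 = 0 → snR h x y ≤ 2 * h := by intro; unfold snR; split_ifs <;> omega
  simp only [snP]
  constructor
  · have : 0 ≤ x / 2 := by omega
    have := hr.1
    have : 0 ≤ h := by omega
    positivity
  · by_cases hx : x % 2 = 0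
    · have a : x / 2 ≤ h := by omega
      have := hr2 hx
      nlinarith
    · have a : x / 2 ≤ h - 1 := by omega
      nlinarith

theorem snP_inj (h x y u v : ℤ) (hp : snIn h x y) (hq : snIn h u v)
    (he : snP h (x, y) = snP h (u, v)) : x = u ∧ y = v := by
  obtain ⟨h1, h2, h3, h4, h5, h6⟩ := hp
  obtain ⟨g1, g2, g3, g4, g5, g6⟩ := hq
  have hr : 0 ≤ snR h x y ∧ snR h x y ≤ 2 * h + 1 := by unfold snR; split_ifs <;> omega
  have hr' : 0 ≤ snR h u v ∧ snR h u v ≤ 2 * h + 1 := by unfold snR; split_ifs <;> omega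
  simp only [snP] at he
  have e : x / 2 = u / 2 := by
    rcases lt_trichotomy (x / 2) (u / 2) with hlt | hlt | hlt
    · nlinarith
    · exact hlt
    · nlinarith
  rw [e] at he
  have he' : snR h x y = snR h u v := by linarith
  unfold snR at he'
  split_ifs at he' <;> omega

theorem snP_lip (h x y u v : ℤ) (hp : snIn h x y) (hq : snIn h u v)
    (ha : c1Adj (x, y) (u, v)) : snP h (u, v) ≤ snP h (x, y) + 1 := by
  obtain ⟨h1, h2, h3, h4, h5, h6⟩ := hp
  obtain ⟨g1, g2, g3, g4, g5, g6⟩ := hq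
  simp only [c1Adj] at ha
  simp only [snP]
  have hx : u / 2 = x / 2 ∨ u / 2 = x / 2 + 1 ∨ u / 2 = x / 2 - 1 := by
    rcases ha with ⟨a, b⟩ | ⟨a, b⟩
    · rcases (abs_eq (by norm_num)).1 a with a | a <;> omega
    · omega
  have hA : (x - u = 1 ∨ x - u = -1) ∧ y = v ∨ x = u ∧ (y - v = 1 ∨ y - v = -1) := by
    rwa [abs_eq (by norm_num), abs_eq (by norm_num)] at ha
  have key : (2 * h + 2) * (u / 2 - x / 2) ≤ snR h x y + 1 - snR h u v := by
    rcases hx with e | e | e <;> rw [e]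
    · ring_nf
      unfold snR; split_ifs <;> omega
    · ring_nf
      unfold snR; split_ifs <;> omega
    · ring_nf
      unfold snR; split_ifs <;> omega
  linarith

theorem snP_succ (h x y : ℤ) (hp : snIn h x y) (hL : snP h (x, y) < (2 * h + 2) * h + 2 * h) :
    ∃ u v, snIn h u v ∧ c1Adj (x, y) (u, v) ∧ snP h (u, v) = snP h (x, y) + 1 := by
  obtain ⟨h1, h2, h3, h4, h5, h6⟩ := hp
  have hend : x = 2 * h → snR h x y < 2 * h := by
    intro e
    simp only [snP] at hL
    have : x / 2 = h := by omega
    rw [this] at hL; linarith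
  have red : ∀ u v, (2 * h + 2) * (u / 2 - x / 2) = snR h x y + 1 - snR h u v →
      snP h (u, v) = snP h (x, y) + 1 := by
    intro u v e; simp only [snP]; linarith
  have cs : x % 4 = 0 ∨ x % 4 = 1 ∨ x % 4 = 2 ∨ x % 4 = 3 := by omega
  have st : ∀ u v, u / 2 = x / 2 → snR h u v = snR h x y + 1 →
      snP h (u, v) = snP h (x, y) + 1 := by
    intro u v e e'; apply red; rw [e, e']; ring
  have st' : ∀ u v, u / 2 = x / 2 + 1 → snR h u v + (2 * h + 2) = snR h x y + 1 →
      snP h (u, v) = snP h (x, y) + 1 := by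
    intro u v e e'; apply red; rw [e]; linarith
  unfold snR at hend
  rcases cs with c | c | c | c
  · by_cases hy : y = 0
    · refine ⟨x + 1, y, ?_, by left; simp, st _ _ (by omega) ?_⟩
      · unfold snIn; split_ifs at hend <;> omega
      · unfold snR; split_ifs <;> omega
    · refine ⟨x, y - 1, ?_, by right; simp, st _ _ (by omega) ?_⟩
      · unfold snIn; omega
      · unfold snR; split_ifs <;> omega
  · refine ⟨x + 1, y, ?_, by left; simp, st' _ _ (by omega) ?_⟩
    · unfold snIn; omega
    · unfold snR; split_ifs <;> omega
  · by_cases hy : y = 2 * h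
    · refine ⟨x + 1, y, ?_, by left; simp, st _ _ (by omega) ?_⟩
      · unfold snIn; split_ifs at hend <;> omega
      · unfold snR; split_ifs <;> omega
    · refine ⟨x, y + 1, ?_, by right; simp, st _ _ (by omega) ?_⟩
      · unfold snIn; omega
      · unfold snR; split_ifs <;> omega
  · refine ⟨x + 1, y, ?_, by left; simp, st' _ _ (by omega) ?_⟩
    · unfold snIn; omega
    · unfold snR; split_ifs <;> omega

theorem snP_pred (h x y : ℤ) (hp : snIn h x y) (hL : 0 < snP h (x, y)) :
    ∃ u v, snIn h u v ∧ c1Adj (x, y) (u, v) ∧ snP h (u, v) + 1 = snP h (x, y) := by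
  obtain ⟨h1, h2, h3, h4, h5, h6⟩ := hp
  have hend : x = 0 → 0 < snR h x y := by
    intro e
    simp only [snP] at hL
    have : x / 2 = 0 := by omega
    rw [this] at hL; linarith
  have red : ∀ u v, (2 * h + 2) * (u / 2 - x / 2) = snR h x y - 1 - snR h u v →
      snP h (u, v) + 1 = snP h (x, y) := by
    intro u v e; simp only [snP]; linarith
  have cs : x % 4 = 0 ∨ x % 4 = 1 ∨ x % 4 = 2 ∨ x % 4 = 3 := by omega
  have st : ∀ u v, u / 2 = x / 2 → snR h u v = snR h x y - 1 →
      snP h (u, v) + 1 = snP h (x, y) := by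
    intro u v e e'; apply red; rw [e, e']; ring
  have st' : ∀ u v, u / 2 = x / 2 - 1 → snR h u v - (2 * h + 2) = snR h x y - 1 →
      snP h (u, v) + 1 = snP h (x, y) := by
    intro u v e e'; apply red; rw [e]; linarith
  unfold snR at hend
  rcases cs with c | c | c | c
  · by_cases hy : y = 2 * h
    · refine ⟨x - 1, y, ?_, by left; simp, st' _ _ (by omega) ?_⟩
      · unfold snIn; split_ifs at hend <;> omega
      · unfold snR; split_ifs <;> omega
    · refine ⟨x, y + 1, ?_, by right; simp, st _ _ (by omega) ?_⟩
      · unfold snIn; omega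
      · unfold snR; split_ifs <;> omega
  · refine ⟨x - 1, y, ?_, by left; simp, st _ _ (by omega) ?_⟩
    · unfold snIn; omega
    · unfold snR; split_ifs <;> omega
  · by_cases hy : y = 0
    · refine ⟨x - 1, y, ?_, by left; simp, st' _ _ (by omega) ?_⟩
      · unfold snIn; omega
      · unfold snR; split_ifs <;> omega
    · refine ⟨x, y - 1, ?_, by right; simp, st _ _ (by omega) ?_⟩
      · unfold snIn; omega
      · unfold snR; split_ifs <;> omega
  · refine ⟨x - 1, y, ?_, by left; simp, st _ _ (by omega) ?_⟩
    · unfold snIn; omega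
    · unfold snR; split_ifs <;> omega

theorem diam_snake (h : ℕ) (S : Set (ℤ × ℤ)) (hS : ∀ x y : ℤ, (x, y) ∈ S ↔ snIn h x y) :
    diamSP c1Adj S = (2 * h + 2) * h + 2 * h := by
  apply diamSP_eq
  · rintro ⟨x, y⟩ ha ⟨u, v⟩ hb
    refine ⟨_, ?_, pathIn_of_descent (u, v)
      (fun p => (snP h p - snP h (u, v)).natAbs) ?_ ?_ _ (x, y) ha rfl⟩
    · have h1 := snP_bounds _ _ _ ((hS _ _).1 ha)
      have h2 := snP_bounds _ _ _ ((hS _ _).1 hb)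
      zify
      rw [abs_le]; constructor <;> linarith
    · rintro ⟨x, y⟩ hp e
      try dsimp only at e
      have := snP_inj _ _ _ _ _ ((hS _ _).1 hp) ((hS _ _).1 hb) (by omega)
      rw [this.1, this.2]
    · rintro ⟨x, y⟩ hp e
      try dsimp only at e
      have h2 := snP_bounds _ _ _ ((hS _ _).1 hb)
      rcases lt_trichotomy (snP h (x, y)) (snP h (u, v)) with g | g | g
      · obtain ⟨s, t, q1, q2, q3⟩ := snP_succ _ _ _ ((hS _ _).1 hp) (by linarith)
        exact ⟨(s, t), (hS _ _).2 q1, q2, by omega⟩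
      · omega
      · obtain ⟨s, t, q1, q2, q3⟩ := snP_pred _ _ _ ((hS _ _).1 hp) (by linarith)
        exact ⟨(s, t), (hS _ _).2 q1, q2, by omega⟩
  · obtain ⟨y, hy, hy'⟩ : ∃ y : ℤ, snIn h (2 * h) y ∧ snR h (2 * h) y = 2 * h := by
      by_cases c : (2 * h : ℤ) % 4 = 0
      · refine ⟨0, ?_, ?_⟩
        · unfold snIn; omega
        · unfold snR; split_ifs <;> omega
      · refine ⟨2 * h, ?_, ?_⟩
        · unfold snIn; omega
        · unfold snR; split_ifs <;> omega
    refine ⟨(0, 2 * h), (hS _ _).2 (by unfold snIn; omega), (2 * h, y), (hS _ _).2 hy,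
      fun m hm => ?_⟩
    have := pathIn_lip (snP h) ?_ hm
    · simp only [snP, hy'] at this
      have e : (2 * h : ℤ) / 2 = h := by omega
      rw [e] at this
      simp [snR] at this
      zify; exact this
    · rintro ⟨x, y⟩ hp ⟨u, v⟩ hq a
      exact snP_lip _ _ _ _ _ ((hS _ _).1 hp) ((hS _ _).1 hq) a

theorem shortestPath_diam_square_and_snake
    (n : ℕ) (hn : 2 ≤ n) (hne : Even n)
    (Q S : Set (ℤ × ℤ))
    (hQ : Q = Set.Icc (0 : ℤ) (n : ℤ) ×ˢ Set.Icc (0 : ℤ) (n : ℤ))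
    (hS : S = Q \ ((⋃ k : ℤ, ({4 * k + 1} : Set ℤ) ×ˢ Set.Icc (1 : ℤ) (n : ℤ)) ∪
                   (⋃ k : ℤ, ({4 * k + 3} : Set ℤ) ×ˢ Set.Icc (0 : ℤ) ((n : ℤ) - 1)))) :
    diamSP c1Adj Q = 2 * n ∧ diamSP c1Adj S = n + n * (1 + n / 2) ∧
      |(diamSP c1Adj Q : ℤ) - (diamSP c1Adj S : ℤ)| = n ^ 2 / 2 := by
  obtain ⟨h, rfl⟩ := hne
  have h1 : diamSP c1Adj Q = 2 * (h + h) := by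
    apply diam_square
    intro x y
    rw [hQ]
    simp only [Set.mem_prod, Set.mem_Icc]
    tauto
  have h2 : diamSP c1Adj S = (2 * h + 2) * h + 2 * h := by
    apply diam_snake
    intro x y
    rw [hS, hQ]
    simp only [Set.mem_diff, Set.mem_union, Set.mem_iUnion, Set.mem_prod, Set.mem_Icc,
      Set.mem_singleton_iff, snIn]
    push_cast
    constructor
    · rintro ⟨⟨⟨a, b⟩, c, d⟩, e⟩
      refine ⟨a, by omega, c, by omega, ?_, ?_⟩
      · intro g
        by_contra w
        exact e (Or.inl ⟨x / 4, by omega, by omega, by omega⟩)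
      · intro g
        by_contra w
        exact e (Or.inr ⟨x / 4, by omega, by omega, by omega⟩)
    · rintro ⟨a, b, c, d, e, f⟩
      refine ⟨⟨⟨a, by omega⟩, c, by omega⟩, ?_⟩
      rintro (⟨k, g1, g2, g3⟩ | ⟨k, g1, g2, g3⟩) <;> omega
  refine ⟨h1, ?_, ?_⟩
  · rw [h2]
    have : (h + h) / 2 = h := by omega
    rw [this]; ring
  · rw [h1, h2]
    push_cast
    have e : ((h : ℤ) + h) ^ 2 = 2 * (2 * h ^ 2) := by ring
    rw [e, Int.mul_ediv_cancel_left _ (by norm_num)]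
    have e2 : 2 * ((h : ℤ) + h) - ((2 * h + 2) * h + 2 * h) = - (2 * h ^ 2) := by ring
    rw [e2, abs_neg, abs_of_nonneg (by positivity)]
end

section
/- Let n ≥ 1, let A = [0,n]ℤ × [0,2]ℤ ⊂ ℤ² and let B = A \ ([1,n]ℤ × {1}). Then, with respect to the shortest-path metric induced by c₁-adjacency within each set, diam_{c₁}(A) = n + 2 and diam_{c₁}(B) = 2n + 2; hence |diam_{c₁}(A) − diam_{c₁}(B)| = n. -/
theorem path_exists_aux {α : Type*} (adj : α → α → Prop) (X : Set α) (b : α) (D : α → ℕ)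
    (h0 : ∀ a ∈ X, D a = 0 → a = b)
    (h1 : ∀ a ∈ X, D a ≠ 0 → ∃ c ∈ X, adj a c ∧ D c < D a) :
    ∀ k : ℕ, ∀ a ∈ X, D a ≤ k → ∃ m ≤ k, pathIn adj X m a b := by
  intro k
  induction k with
  | zero =>
    intro a ha hk
    have := h0 a ha (by omega)
    subst this
    exact ⟨0, le_rfl, fun _ => a, rfl, rfl, fun _ _ => ha, fun i hi => by omega⟩
  | succ k ih =>
    intro a ha hk
    by_cases hz : D a = 0
    · obtain ⟨m, hm, hp⟩ := ih a ha (by omega)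
      exact ⟨m, by omega, hp⟩
    · obtain ⟨c, hc, hac, hlt⟩ := h1 a ha hz
      obtain ⟨m, hm, f, hf0, hfm, hfX, hfa⟩ := ih c hc (by omega)
      refine ⟨m + 1, by omega, fun i => Nat.casesOn i a f, rfl, hfm, ?_, ?_⟩
      · intro i hi
        cases i with
        | zero => exact ha
        | succ j => exact hfX j (by omega)
      · intro i hi
        cases i with
        | zero =>
          change adj a (f 0)
          rw [hf0]; exact hac
        | succ j => exact hfa j (by omega)

theorem path_lower_aux {α : Type*} (adj : α → α → Prop) (X : Set α) (φ : α → ℤ)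
    (h : ∀ x ∈ X, ∀ y ∈ X, adj x y → φ y ≤ φ x + 1) (m : ℕ) (a b : α)
    (hp : pathIn adj X m a b) : φ b ≤ φ a + m := by
  obtain ⟨f, hf0, hfm, hfX, hfa⟩ := hp
  have key : ∀ i : ℕ, i ≤ m → φ (f i) ≤ φ a + i := by
    intro i
    induction i with
    | zero => intro _; simp [hf0]
    | succ j ih =>
      intro hj
      have h1 := ih (by omega)
      have h2 := h _ (hfX j (by omega)) _ (hfX (j + 1) hj) (hfa j (by omega))
      push_cast
      omega
  rw [← hfm]
  exact key m le_rfl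

theorem diam_aux {α : Type*} (adj : α → α → Prop) (X : Set α) (N : ℕ)
    (hub : ∀ a ∈ X, ∀ b ∈ X, ∃ m ≤ N, pathIn adj X m a b)
    (p q : α) (hp : p ∈ X) (hq : q ∈ X) (hlb : ∀ m, pathIn adj X m p q → N ≤ m) :
    diamSP adj X = N := by
  have hle : ∀ a ∈ X, ∀ b ∈ X, dSP adj X a b ≤ N := by
    intro a ha b hb
    obtain ⟨m, hm, hpm⟩ := hub a ha b hb
    exact (Nat.sInf_le hpm).trans hm
  have heq : dSP adj X p q = N := by
    apply le_antisymm (hle p hp q hq)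
    obtain ⟨m, hm, hpm⟩ := hub p hp q hq
    exact hlb _ (Nat.sInf_mem (s := {m : ℕ | pathIn adj X m p q}) ⟨m, hpm⟩)
  have hg : IsGreatest {d : ℕ | ∃ a ∈ X, ∃ b ∈ X, d = dSP adj X a b} N := by
    refine ⟨⟨p, hp, q, hq, heq.symm⟩, ?_⟩
    rintro d ⟨a, ha, b, hb, rfl⟩
    exact hle a ha b hb
  exact hg.csSup_eq

/-- Position along the C-shaped set. -/
def phiC (x : ℤ × ℤ) : ℤ := if x.2 = 0 then -(x.1 + 1) else if x.2 = 1 then 0 else x.1 + 1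

theorem diamA_aux (n : ℕ) (A : Set (ℤ × ℤ))
    (hA : ∀ x y : ℤ, (x, y) ∈ A ↔ 0 ≤ x ∧ x ≤ n ∧ 0 ≤ y ∧ y ≤ 2) :
    diamSP c1Adj A = n + 2 := by
  apply diam_aux c1Adj A (n + 2) ?_ (0, 0) (n, 2) ((hA _ _).2 (by omega)) ((hA _ _).2 (by omega))
  · intro m hm
    have := path_lower_aux c1Adj A (fun x => x.1 + x.2) ?_ m _ _ hm
    · simp only at this; omega
    · rintro ⟨x, y⟩ _ ⟨u, v⟩ _ h
      simp only [c1Adj, Int.abs_eq_natAbs] at h ⊢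
      omega
  · rintro ⟨x, y⟩ ha ⟨u, v⟩ hb
    have hb' := (hA _ _).1 hb
    have ha' := (hA _ _).1 ha
    apply path_exists_aux c1Adj A (u, v) (fun a => (a.1 - u).natAbs + (a.2 - v).natAbs)
      ?_ ?_ (n + 2) (x, y) ha (by simp only; omega)
    · rintro ⟨x, y⟩ _ h
      simp only [Prod.mk.injEq] at h ⊢
      omega
    · rintro ⟨x, y⟩ ha h
      have ha' := (hA _ _).1 ha
      simp only at h
      rcases lt_trichotomy x u with h1 | h1 | h1
      · exact ⟨(x + 1, y), (hA _ _).2 (by omega), by simp [c1Adj], by simp only; omega⟩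
      · rcases lt_trichotomy y v with h2 | h2 | h2
        · exact ⟨(x, y + 1), (hA _ _).2 (by omega), by simp [c1Adj],
            by simp only; omega⟩
        · omega
        · exact ⟨(x, y - 1), (hA _ _).2 (by omega), by simp [c1Adj],
            by simp only; omega⟩
      · exact ⟨(x - 1, y), (hA _ _).2 (by omega), by simp [c1Adj], by simp only; omega⟩

theorem diamB_aux (n : ℕ) (B : Set (ℤ × ℤ))
    (hB : ∀ x y : ℤ, (x, y) ∈ B ↔ (0 ≤ x ∧ x ≤ n ∧ 0 ≤ y ∧ y ≤ 2) ∧ (y = 1 → x = 0)) :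
    diamSP c1Adj B = 2 * n + 2 := by
  have up : ∀ x y : ℤ, (x, y) ∈ B → phiC (x, y) < n + 1 →
      ∃ c ∈ B, c1Adj (x, y) c ∧ phiC c = phiC (x, y) + 1 := by
    intro x y h hlt
    have h' := (hB _ _).1 h
    have hy : (y = 0 ∧ x = 0) ∨ (y = 0 ∧ 0 < x) ∨ y = 1 ∨ y = 2 := by omega
    rcases hy with ⟨rfl, rfl⟩ | ⟨rfl, hx⟩ | rfl | rfl
    · exact ⟨(0, 1), (hB _ _).2 (by omega), by simp [c1Adj], by simp [phiC]⟩
    · exact ⟨(x - 1, 0), (hB _ _).2 (by omega), by simp [c1Adj], by simp [phiC]⟩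
    · exact ⟨(x, 2), (hB _ _).2 (by omega), by simp [c1Adj], by simp [phiC]; omega⟩
    · simp [phiC] at hlt
      exact ⟨(x + 1, 2), (hB _ _).2 (by omega), by simp [c1Adj], by simp [phiC]⟩
  have down : ∀ x y : ℤ, (x, y) ∈ B → -(n + 1 : ℤ) < phiC (x, y) →
      ∃ c ∈ B, c1Adj (x, y) c ∧ phiC c = phiC (x, y) - 1 := by
    intro x y h hlt
    have h' := (hB _ _).1 h
    have hy : (y = 2 ∧ x = 0) ∨ (y = 2 ∧ 0 < x) ∨ y = 1 ∨ y = 0 := by omega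
    rcases hy with ⟨rfl, rfl⟩ | ⟨rfl, hx⟩ | rfl | rfl
    · exact ⟨(0, 1), (hB _ _).2 (by omega), by simp [c1Adj], by simp [phiC]⟩
    · exact ⟨(x - 1, 2), (hB _ _).2 (by omega), by simp [c1Adj], by simp [phiC]⟩
    · exact ⟨(x, 0), (hB _ _).2 (by omega), by simp [c1Adj], by simp [phiC]; omega⟩
    · simp [phiC] at hlt
      exact ⟨(x + 1, 0), (hB _ _).2 (by omega), by simp [c1Adj], by simp [phiC]; omega⟩
  have bd : ∀ a ∈ B, -(n + 1 : ℤ) ≤ phiC a ∧ phiC a ≤ n + 1 := by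
    rintro ⟨x, y⟩ h
    have h' := (hB _ _).1 h
    simp only [phiC]
    split_ifs <;> omega
  apply diam_aux c1Adj B (2 * n + 2) ?_ (n, 0) (n, 2) ((hB _ _).2 (by omega))
    ((hB _ _).2 (by omega))
  · intro m hm
    have := path_lower_aux c1Adj B phiC ?_ m _ _ hm
    · simp [phiC] at this; omega
    · rintro ⟨x, y⟩ h1 ⟨u, v⟩ h2 h
      have h1' := (hB _ _).1 h1
      have h2' := (hB _ _).1 h2
      simp only [c1Adj, phiC, Int.abs_eq_natAbs] at h ⊢
      split_ifs <;> omega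
  · intro a ha b hb
    have hb' := bd b hb
    have ha' := bd a ha
    apply path_exists_aux c1Adj B b (fun a => (phiC a - phiC b).natAbs)
      ?_ ?_ (2 * n + 2) a ha (by omega)
    · rintro ⟨x, y⟩ h1 h
      obtain ⟨u, v⟩ := b
      have h1' := (hB _ _).1 h1
      have h2' := (hB _ _).1 hb
      simp only [Prod.mk.injEq, phiC] at h ⊢
      split_ifs at h <;> omega
    · rintro ⟨x, y⟩ h1 h
      have h1' := bd _ h1
      rcases lt_or_ge (phiC (x, y)) (phiC b) with h2 | h2
      · obtain ⟨c, hc, hc1, hc2⟩ := up x y h1 (by omega)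
        exact ⟨c, hc, hc1, by omega⟩
      · obtain ⟨c, hc, hc1, hc2⟩ := down x y h1 (by omega)
        exact ⟨c, hc, hc1, by omega⟩

/-- For `A = [0,n]ℤ × [0,2]ℤ` and `B = A \ ([1,n]ℤ × {1})`,
the `c₁`-shortest-path diameters are `n + 2` and `2n + 2` respectively;
hence they differ by `n`. -/
theorem shortestPath_diam_rect_and_C_c1
    (n : ℕ) (hn : 1 ≤ n)
    (A B : Set (ℤ × ℤ))
    (hA : A = Set.Icc (0 : ℤ) (n : ℤ) ×ˢ Set.Icc (0 : ℤ) (2 : ℤ))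
    (hB : B = A \ (Set.Icc (1 : ℤ) (n : ℤ) ×ˢ ({1} : Set ℤ))) :
    diamSP c1Adj A = n + 2 ∧ diamSP c1Adj B = 2 * n + 2 ∧
      |(diamSP c1Adj A : ℤ) - (diamSP c1Adj B : ℤ)| = n := by
  have h1 : diamSP c1Adj A = n + 2 := by
    apply diamA_aux
    intro x y
    simp only [hA, Set.mem_prod, Set.mem_Icc]
    omega
  have h2 : diamSP c1Adj B = 2 * n + 2 := by
    apply diamB_aux
    intro x y
    simp only [hB, hA, Set.mem_sdiff, Set.mem_prod, Set.mem_Icc, Set.mem_singleton_iff]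
    omega
  refine ⟨h1, h2, ?_⟩
  rw [h1, h2, Int.abs_eq_natAbs]
  omega
end

section
/- Let 1 ≤ u ≤ n, let p ≥ 1, let X ⊆ ℤⁿ be c_u-connected, and let A and B be finite, nonempty, c_u-connected subsets of X. Let m ∈ ℕ. If H_{(X,c_u)}(A,B) ≤ m, then the Hausdorff distance based on the ℓ_p metric satisfies H_p(A,B) ≤ m·u^{1/p}. -/
/-- `c_u`-adjacency on `ℤⁿ`: distinct points, each coordinate differs by at
most 1, and at most `u` coordinates differ. -/
def cuAdj {n : ℕ} (u : ℕ) (x y : Fin n → ℤ) : Prop :=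
  x ≠ y ∧ (∀ i, |x i - y i| ≤ 1) ∧
    (Finset.univ.filter (fun i => x i ≠ y i)).card ≤ u

/-- A set is `adj`-connected if any two of its points are joined by a path in it. -/
def connectedIn {α : Type*} (adj : α → α → Prop) (X : Set α) : Prop :=
  ∀ a ∈ X, ∀ b ∈ X, ∃ m : ℕ, pathIn adj X m a b

/-- The Hausdorff "metric" between `A, B ⊆ X` based on shortest paths in `X`:
the least `ε` such that each point of either set is joined by a path in `X` of
length at most `ε` to a point of the other set. -/
noncomputable def hausdSP {α : Type*} (adj : α → α → Prop) (X A B : Set α) : ℕ :=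
  sInf {ε : ℕ | (∀ a ∈ A, ∃ b ∈ B, ∃ m ≤ ε, pathIn adj X m a b) ∧
                (∀ b ∈ B, ∃ a ∈ A, ∃ m ≤ ε, pathIn adj X m b a)}

/-- The `ℓ_p` metric on `ℤⁿ` (with `p ≥ 1` a real exponent). -/
noncomputable def lpDistZ {n : ℕ} (p : ℝ) (x y : Fin n → ℤ) : ℝ :=
  (∑ i, |(x i : ℝ) - (y i : ℝ)| ^ p) ^ (1 / p)

/-- Hausdorff distance between sets `A`, `B` based on a real-valued
distance function `d`, as the infimum of the admissible bounds `ε`. -/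
noncomputable def hausd {α : Type*} (d : α → α → ℝ) (A B : Set α) : ℝ :=
  sInf {ε : ℝ | 0 ≤ ε ∧ (∀ a ∈ A, ∃ b ∈ B, d a b ≤ ε) ∧
                (∀ b ∈ B, ∃ a ∈ A, d a b ≤ ε)}

theorem lpDistZ_triangle {n : ℕ} (p : ℝ) (hp : 1 ≤ p) (x y z : Fin n → ℤ) :
    lpDistZ p x z ≤ lpDistZ p x y + lpDistZ p y z := by
  unfold lpDistZ
  have h := Real.Lp_add_le Finset.univ (fun i => (x i : ℝ) - y i) (fun i => (y i : ℝ) - z i) hp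
  simpa using h

theorem lpDistZ_self {n : ℕ} (p : ℝ) (hp : 1 ≤ p) (x : Fin n → ℤ) : lpDistZ p x x = 0 := by
  unfold lpDistZ
  have h0 : p ≠ 0 := by linarith
  simp [Real.zero_rpow h0, h0]

theorem lpDistZ_comm {n : ℕ} (p : ℝ) (x y : Fin n → ℤ) : lpDistZ p x y = lpDistZ p y x := by
  unfold lpDistZ
  simp only [abs_sub_comm]

theorem lpDistZ_adj {n : ℕ} (u : ℕ) (p : ℝ) (hp : 1 ≤ p) (x y : Fin n → ℤ)
    (h : cuAdj u x y) : lpDistZ p x y ≤ (u : ℝ) ^ (1 / p) := by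
  unfold lpDistZ
  obtain ⟨-, h1, h2⟩ := h
  have h0 : p ≠ 0 := by linarith
  apply Real.rpow_le_rpow (Finset.sum_nonneg fun i _ => by positivity) _ (by positivity)
  calc ∑ i, |(x i : ℝ) - (y i : ℝ)| ^ p ≤ ∑ i, (if x i ≠ y i then (1 : ℝ) else 0) := by
        apply Finset.sum_le_sum
        intro i _
        split_ifs with hi
        · apply Real.rpow_le_one (abs_nonneg _) _ (by linarith)
          exact_mod_cast h1 i
        · push Not at hi
          simp [hi, Real.zero_rpow h0]
    _ = ((Finset.univ.filter (fun i => x i ≠ y i)).card : ℝ) := by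
        rw [Finset.sum_boole]
    _ ≤ u := by exact_mod_cast h2

theorem lpDistZ_path {n : ℕ} (u : ℕ) (p : ℝ) (hp : 1 ≤ p) (X : Set (Fin n → ℤ)) (k : ℕ)
    (a b : Fin n → ℤ) (h : pathIn (cuAdj u) X k a b) :
    lpDistZ p a b ≤ (k : ℝ) * (u : ℝ) ^ (1 / p) := by
  obtain ⟨f, rfl, rfl, -, hadj⟩ := h
  induction k with
  | zero => simp [lpDistZ_self p hp]
  | succ k ih =>
    have h1 := ih (fun i hi => hadj i (by omega))
    have h2 := lpDistZ_adj u p hp _ _ (hadj k (by omega))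
    have h3 := lpDistZ_triangle p hp (f 0) (f k) (f (k + 1))
    push_cast
    linarith

theorem exists_bound_path {α : Type*} (adj : α → α → Prop) (X A B : Set α)
    (hX : connectedIn adj X) (hAX : A ⊆ X) (hBX : B ⊆ X) (hA : A.Finite) (hB : B.Nonempty) :
    ∃ N : ℕ, ∀ a ∈ A, ∃ b ∈ B, ∃ m ≤ N, pathIn adj X m a b := by
  obtain ⟨b, hb⟩ := hB
  have h : ∀ a, ∃ m, a ∈ A → pathIn adj X m a b := by
    intro a
    by_cases ha : a ∈ A
    · obtain ⟨m, hm⟩ := hX a (hAX ha) b (hBX hb)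
      exact ⟨m, fun _ => hm⟩
    · exact ⟨0, fun h => absurd h ha⟩
  choose k hk using h
  obtain ⟨N, hN⟩ := (hA.image k).bddAbove
  exact ⟨N, fun a ha => ⟨b, hb, k a, hN ⟨a, ha, rfl⟩, hk a ha⟩⟩

/-- If `A, B` are finite nonempty `c_u`-connected subsets of a
`c_u`-connected `X ⊆ ℤⁿ` and `H_{(X,c_u)}(A,B) ≤ m`, then
`H_p(A,B) ≤ m · u^{1/p}`. -/
theorem lp_hausdorff_le_of_shortestPath_hausdorff
    {n : ℕ} (u : ℕ) (hu1 : 1 ≤ u) (hun : u ≤ n)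
    (p : ℝ) (hp : 1 ≤ p)
    (X A B : Set (Fin n → ℤ))
    (hXconn : connectedIn (cuAdj u) X)
    (hAX : A ⊆ X) (hBX : B ⊆ X)
    (hAfin : A.Finite) (hBfin : B.Finite)
    (hAne : A.Nonempty) (hBne : B.Nonempty)
    (hAconn : connectedIn (cuAdj u) A) (hBconn : connectedIn (cuAdj u) B)
    (m : ℕ) (hH : hausdSP (cuAdj u) X A B ≤ m) :
    hausd (lpDistZ p) A B ≤ (m : ℝ) * (u : ℝ) ^ (1 / p) := by
  obtain ⟨N, hN⟩ := exists_bound_path (cuAdj u) X A B hXconn hAX hBX hAfin hBne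
  obtain ⟨M, hM⟩ := exists_bound_path (cuAdj u) X B A hXconn hBX hAX hBfin hAne
  have hne : {ε : ℕ | (∀ a ∈ A, ∃ b ∈ B, ∃ m ≤ ε, pathIn (cuAdj u) X m a b) ∧
                (∀ b ∈ B, ∃ a ∈ A, ∃ m ≤ ε, pathIn (cuAdj u) X m b a)}.Nonempty := by
    refine ⟨max N M, fun a ha => ?_, fun b hb => ?_⟩
    · obtain ⟨b, hb, k, hk, h⟩ := hN a ha
      exact ⟨b, hb, k, hk.trans (le_max_left _ _), h⟩
    · obtain ⟨a, ha, k, hk, h⟩ := hM b hb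
      exact ⟨a, ha, k, hk.trans (le_max_right _ _), h⟩
  obtain ⟨h1, h2⟩ := Nat.sInf_mem hne
  have key : ∀ k : ℕ, k ≤ hausdSP (cuAdj u) X A B →
      (k : ℝ) * (u : ℝ) ^ (1 / p) ≤ (m : ℝ) * (u : ℝ) ^ (1 / p) := by
    intro k hk
    have : (k : ℝ) ≤ m := by exact_mod_cast hk.trans hH
    gcongr
  unfold hausd
  apply csInf_le ⟨0, fun e he => he.1⟩
  refine ⟨by positivity, fun a ha => ?_, fun b hb => ?_⟩
  · obtain ⟨b, hb, k, hk, h⟩ := h1 a ha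
    exact ⟨b, hb, (lpDistZ_path u p hp X k a b h).trans (key k hk)⟩
  · obtain ⟨a, ha, k, hk, h⟩ := h2 b hb
    refine ⟨a, ha, ?_⟩
    rw [lpDistZ_comm]
    exact (lpDistZ_path u p hp X k b a h).trans (key k hk)
end

section
/- Let n ≥ 1, let B = ([0,n]ℤ × [0,2]ℤ) \ ([1,n]ℤ × {1}) ⊂ ℤ² and let C = [0,n]ℤ × {0} ⊆ B. Then the Hausdorff distances based on the Manhattan metric d₁ and the Euclidean metric d₂ satisfy H₁(B,C) = 2 and H₂(B,C) = 2. -/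
/-- The Euclidean metric on `ℤ²`, real-valued. -/
noncomputable def d2 (x y : ℤ × ℤ) : ℝ :=
  Real.sqrt (((x.1 - y.1 : ℤ) : ℝ) ^ 2 + ((x.2 - y.2 : ℤ) : ℝ) ^ 2)

theorem hausd_aux (d : ℤ × ℤ → ℤ × ℤ → ℝ)
    (h1 : ∀ x y : ℤ, d (x, y) (x, 0) = |(y : ℝ)|)
    (h2 : ∀ x y z : ℤ, |(y : ℝ)| ≤ d (x, y) (z, 0))
    (n : ℕ) :
    hausd d ((Set.Icc (0 : ℤ) (n : ℤ) ×ˢ Set.Icc (0 : ℤ) (2 : ℤ)) \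
              (Set.Icc (1 : ℤ) (n : ℤ) ×ˢ ({1} : Set ℤ)))
      (Set.Icc (0 : ℤ) (n : ℤ) ×ˢ ({0} : Set ℤ)) = 2 := by
  unfold hausd
  apply IsLeast.csInf_eq
  refine ⟨⟨by norm_num, ?_, ?_⟩, ?_⟩
  · rintro ⟨x, y⟩ ⟨⟨hx, hy⟩, -⟩
    refine ⟨(x, 0), ⟨hx, rfl⟩, ?_⟩
    rw [h1, abs_of_nonneg (by exact_mod_cast hy.1)]
    exact_mod_cast hy.2
  · rintro ⟨x, y⟩ ⟨hx, hy⟩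
    obtain rfl : y = 0 := hy
    refine ⟨(x, 0), ⟨⟨hx, by simp⟩, by simp⟩, ?_⟩
    rw [h1]; simp
  · rintro ε ⟨-, h, -⟩
    obtain ⟨⟨z, w⟩, ⟨-, hw⟩, hd⟩ := h (0, 2) (by simp)
    obtain rfl : w = 0 := hw
    have := (h2 0 2 z).trans hd
    simpa using this

/-- For `B = ([0,n]ℤ × [0,2]ℤ) \ ([1,n]ℤ × {1})` and
`C = [0,n]ℤ × {0}`, the Hausdorff distances based on the Manhattan and
Euclidean metrics satisfy `H₁(B,C) = 2` and `H₂(B,C) = 2`. -/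
theorem hausdorff_C_and_bottom_row
    (n : ℕ) (hn : 1 ≤ n)
    (B C : Set (ℤ × ℤ))
    (hB : B = (Set.Icc (0 : ℤ) (n : ℤ) ×ˢ Set.Icc (0 : ℤ) (2 : ℤ)) \
              (Set.Icc (1 : ℤ) (n : ℤ) ×ˢ ({1} : Set ℤ)))
    (hC : C = Set.Icc (0 : ℤ) (n : ℤ) ×ˢ ({0} : Set ℤ)) :
    hausd d1 B C = 2 ∧ hausd d2 B C = 2 := by
  subst hB hC
  constructor
  · apply hausd_aux
    · intro x y
      simp [d1]
    · intro x y z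
      simp [d1]
  · apply hausd_aux
    · intro x y
      simp [d2, Real.sqrt_sq_eq_abs]
    · intro x y z
      unfold d2
      apply Real.abs_le_sqrt
      simp
      positivity
end
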